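/- For every δ > 0 there exists n₀ ∈ ℕ such that for all n > n₀: every even permutation h of Z₂ⁿ can be realized by a reversible circuit with n inputs (no additional inputs), consisting of gates from Ωₙ², which simultaneously contains at most (16 + δ)·n·2ⁿ/log₂ n gates of types NOT and CNOT and at most (32 + δ)·n·2ⁿ/log₂ n gates of type 2-CNOT. -/

import Mathlib

namespace RevCirc

/-- A reversible gate on `n` wires: a target coordinate together with a set of
at most two control coordinates not containing the target.  With no controls it
is a NOT gate, with one control a CNOT gate and with two controls a 2-CNOT
(Toffoli) gate. -/
abbrev Gate (n : ℕ) : Type :=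
  {p : Fin n × Finset (Fin n) // p.2.card ≤ 2 ∧ p.1 ∉ p.2}

def Gate.target {n : ℕ} (g : Gate n) : Fin n := g.1.1

def Gate.controls {n : ℕ} (g : Gate n) : Finset (Fin n) := g.1.2

/-- The transformation of `ℤ₂ⁿ` defined by a gate: the target coordinate is
XOR-ed with the conjunction of the control coordinates. -/
def Gate.apply {n : ℕ} (g : Gate n) (x : Fin n → Bool) : Fin n → Bool :=
  fun i => if i = g.target then xor (x i) (decide (∀ j ∈ g.controls, x j = true)) else x i

/-- The transformation defined by a circuit (a list of gates, applied left to right). -/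
def evalCircuit {n : ℕ} (c : List (Gate n)) (x : Fin n → Bool) : Fin n → Bool :=
  c.foldl (fun y g => g.apply y) x

/-- A circuit realizes a permutation `h` of `ℤ₂ⁿ` (without additional inputs) if the
composition of its gates equals `h`. -/
def realizes {n : ℕ} (c : List (Gate n)) (h : Equiv.Perm (Fin n → Bool)) : Prop :=
  ∀ x, evalCircuit c x = h x

/-- The expanding function `ℤ₂ⁿ → ℤ₂^{n+q}` padding with zeros. -/
def expand (n q : ℕ) (x : Fin n → Bool) : Fin (n + q) → Bool :=
  fun i => if h : (i : ℕ) < n then x ⟨i, h⟩ else false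

/-- A circuit with `n+q` inputs implements `f : ℤ₂ⁿ → ℤ₂ⁿ` using `q` additional
inputs if for some permutation `π` of the wires, the coordinates `π(1),…,π(n)` of the
output on the zero-padded input give `f`. -/
def implements (n q : ℕ) (c : List (Gate (n + q)))
    (f : (Fin n → Bool) → (Fin n → Bool)) : Prop :=
  ∃ π : Equiv.Perm (Fin (n + q)), ∀ x : Fin n → Bool, ∀ i : Fin n,
    evalCircuit c (expand n q x) (π (Fin.castLE (Nat.le_add_right n q) i)) = f x i

/-- `F(n,q)`: the set of transformations `ℤ₂ⁿ → ℤ₂ⁿ` implementable by reversible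
circuits with `n+q` inputs. -/
def FSet (n q : ℕ) : Set ((Fin n → Bool) → (Fin n → Bool)) :=
  {f | ∃ c : List (Gate (n + q)), implements n q c f}

/-- The set of wires touched by a gate: its target together with its controls. -/
def Gate.support {n : ℕ} (g : Gate n) : Finset (Fin n) := insert g.target g.controls

/-- A circuit has depth 1 if the supports of its gates are pairwise disjoint. -/
def DepthOne {n : ℕ} (c : List (Gate n)) : Prop :=
  c.Pairwise fun g₁ g₂ => Disjoint g₁.support g₂.support

/-- The depth of a circuit: the minimal number of consecutive depth-1 sub-circuits
into which it can be divided. -/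
noncomputable def depth {n : ℕ} (c : List (Gate n)) : ℕ :=
  sInf {d | ∃ parts : List (List (Gate n)),
    parts.flatten = c ∧ (∀ p ∈ parts, DepthOne p) ∧ parts.length = d}

/-- The quantum weight of a circuit: each NOT and CNOT gate weighs `WC`, each
2-CNOT gate weighs `WT`. -/
def weight {n : ℕ} (WC WT : ℝ) (c : List (Gate n)) : ℝ :=
  (c.map fun g => if g.controls.card = 2 then WT else WC).sum

/-- `L(f,q)`: minimal gate complexity of a circuit implementing `f` with `q`
additional inputs. -/
noncomputable def Lmin (n q : ℕ) (f : (Fin n → Bool) → (Fin n → Bool)) : ℕ :=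
  sInf {l | ∃ c : List (Gate (n + q)), implements n q c f ∧ c.length = l}

/-- The Shannon gate complexity function `L(n,q)`. -/
noncomputable def ShannonL (n q : ℕ) : ℕ := sSup (Lmin n q '' FSet n q)

/-- `D(f,q)`: minimal depth of a circuit implementing `f` with `q` additional inputs. -/
noncomputable def Dmin (n q : ℕ) (f : (Fin n → Bool) → (Fin n → Bool)) : ℕ :=
  sInf {d | ∃ c : List (Gate (n + q)), implements n q c f ∧ depth c = d}

/-- The Shannon depth function `D(n,q)`. -/
noncomputable def ShannonD (n q : ℕ) : ℕ := sSup (Dmin n q '' FSet n q)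

/-- `W(f,q)`: minimal quantum weight of a circuit implementing `f` with `q`
additional inputs. -/
noncomputable def Wmin (WC WT : ℝ) (n q : ℕ) (f : (Fin n → Bool) → (Fin n → Bool)) : ℝ :=
  sInf {w | ∃ c : List (Gate (n + q)), implements n q c f ∧ weight WC WT c = w}

/-- The Shannon quantum weight function `W(n,q)`. -/
noncomputable def ShannonW (WC WT : ℝ) (n q : ℕ) : ℝ := sSup (Wmin WC WT n q '' FSet n q)

/-- A permutation is a product of `K` pairwise disjoint (independent) transpositions:
there are `2K` pairwise distinct points `x i, y i` with `g = (x 1, y 1)∘⋯∘(x K, y K)`. -/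
def IsProdOfDisjointTranspositions {X : Type*} [DecidableEq X] (K : ℕ)
    (g : Equiv.Perm X) : Prop :=
  ∃ x y : Fin K → X,
    Function.Injective (Sum.elim x y) ∧
    g = ((List.finRange K).map fun i => Equiv.swap (x i) (y i)).prod

end RevCirc


namespace RevCirc

/-- `f` is computed by a circuit with at most `a` NOT/CNOT gates and `b` Toffoli gates. -/
def RlF {n : ℕ} (f : (Fin n → Bool) → (Fin n → Bool)) (a b : ℕ) : Prop :=
  ∃ c : List (Gate n), (∀ x, evalCircuit c x = f x) ∧
    (c.countP fun g => decide (g.controls.card ≤ 1)) ≤ a ∧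
    (c.countP fun g => decide (g.controls.card = 2)) ≤ b

variable {n : ℕ}

/-- flip wire `t` by `b` -/
def fl (t : Fin n) (b : Bool) (x : Fin n → Bool) : Fin n → Bool :=
  fun i => if i = t then xor (x i) b else x i

/-- conjunction of the controls -/
def al (C : Finset (Fin n)) (x : Fin n → Bool) : Bool := decide (∀ j ∈ C, x j = true)

/-- multiply controlled NOT -/
def mct (C : Finset (Fin n)) (t : Fin n) (x : Fin n → Bool) : Fin n → Bool :=
  fl t (al C x) x

theorem evalCircuit_append (c d : List (Gate n)) (x : Fin n → Bool) :
    evalCircuit (c ++ d) x = evalCircuit d (evalCircuit c x) := by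
  simp [evalCircuit]

theorem gate_apply_eq (g : Gate n) (x : Fin n → Bool) :
    g.apply x = mct g.controls g.target x := by
  funext i; rfl

theorem fl_fl (t : Fin n) (a b : Bool) (x : Fin n → Bool) :
    fl t a (fl t b x) = fl t (xor b a) x := by
  funext i; simp only [fl]; split_ifs <;> simp

theorem fl_false (t : Fin n) (x : Fin n → Bool) : fl t false x = x := by
  funext i; simp [fl]

theorem fl_same (t : Fin n) (b : Bool) (x : Fin n → Bool) : fl t b x t = xor (x t) b := by
  simp [fl]

theorem fl_ne {t i : Fin n} (h : i ≠ t) (b : Bool) (x : Fin n → Bool) : fl t b x i = x i := by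
  simp [fl, h]

theorem fl_comm (t s : Fin n) (a b : Bool) (x : Fin n → Bool) :
    fl t a (fl s b x) = fl s b (fl t a x) := by
  funext i; simp only [fl]; split_ifs <;> simp [Bool.xor_comm, Bool.xor_left_comm]

theorem al_congr {C : Finset (Fin n)} {x y : Fin n → Bool} (h : ∀ j ∈ C, x j = y j) :
    al C x = al C y := by
  unfold al; congr 1; apply propext
  exact ⟨fun H j hj => by rw [← h j hj]; exact H j hj, fun H j hj => by rw [h j hj]; exact H j hj⟩

theorem al_fl {C : Finset (Fin n)} {t : Fin n} (ht : t ∉ C) (b : Bool) (x : Fin n → Bool) :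
    al C (fl t b x) = al C x :=
  al_congr fun j hj => fl_ne (fun h => ht (by rw [← h]; exact hj)) b x

theorem al_insert (C : Finset (Fin n)) (c : Fin n) (x : Fin n → Bool) :
    al (insert c C) x = (x c && al C x) := by
  unfold al; rw [Bool.eq_iff_iff]; simp

theorem al_empty (x : Fin n → Bool) : al ∅ x = true := by simp [al]

theorem mct_mct {C : Finset (Fin n)} {t : Fin n} (ht : t ∉ C) (x : Fin n → Bool) :
    mct C t (mct C t x) = x := by
  simp only [mct, al_fl ht, fl_fl, Bool.xor_self, fl_false]

theorem RlF.comp {f g : (Fin n → Bool) → (Fin n → Bool)} {a b a' b' : ℕ}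
    (hf : RlF f a b) (hg : RlF g a' b') : RlF (fun x => f (g x)) (a + a') (b + b') := by
  obtain ⟨c, h1, h2, h3⟩ := hf
  obtain ⟨d, k1, k2, k3⟩ := hg
  refine ⟨d ++ c, fun x => by rw [evalCircuit_append, k1, h1], ?_, ?_⟩
  · rw [List.countP_append]; omega
  · rw [List.countP_append]; omega

theorem RlF.mono {f : (Fin n → Bool) → (Fin n → Bool)} {a b a' b' : ℕ}
    (hf : RlF f a b) (ha : a ≤ a') (hb : b ≤ b') : RlF f a' b' := by
  obtain ⟨c, h1, h2, h3⟩ := hf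
  exact ⟨c, h1, h2.trans ha, h3.trans hb⟩

theorem RlF.id : RlF (fun x : Fin n → Bool => x) 0 0 :=
  ⟨[], fun _ => rfl, by simp, by simp⟩

theorem RlF.congr {f g : (Fin n → Bool) → (Fin n → Bool)} {a b : ℕ}
    (hf : RlF f a b) (h : ∀ x, g x = f x) : RlF g a b := by
  have : g = f := funext h
  rwa [this]

theorem gate_invol (g : Gate n) (x : Fin n → Bool) : g.apply (g.apply x) = x := by
  rw [gate_apply_eq, gate_apply_eq]; exact mct_mct g.2.2 x

theorem eval_reverse (c : List (Gate n)) : ∀ x, evalCircuit c.reverse (evalCircuit c x) = x := by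
  induction c with
  | nil => intro x; rfl
  | cons g c ih =>
    intro x
    rw [List.reverse_cons, evalCircuit_append]
    have : evalCircuit (g :: c) x = evalCircuit c (g.apply x) := rfl
    rw [this, ih]
    exact gate_invol g x

theorem RlF.inv {f : (Fin n → Bool) → (Fin n → Bool)} {a b : ℕ} (hf : RlF f a b) :
    ∃ g, RlF g a b ∧ (∀ x, g (f x) = x) ∧ (∀ x, f (g x) = x) := by
  obtain ⟨c, h1, h2, h3⟩ := hf
  refine ⟨evalCircuit c.reverse, ⟨c.reverse, fun _ => rfl, by simpa using h2, by simpa using h3⟩,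
    fun x => by rw [← h1, eval_reverse], fun x => ?_⟩
  have := eval_reverse c.reverse x
  rwa [List.reverse_reverse, h1] at this

theorem RlF.inj {f : (Fin n → Bool) → (Fin n → Bool)} {a b : ℕ} (hf : RlF f a b) :
    Function.Injective f := by
  obtain ⟨g, _, h, _⟩ := hf.inv
  exact Function.LeftInverse.injective h

theorem RlF.gate1 {C : Finset (Fin n)} {t : Fin n} (ht : t ∉ C) (hC : C.card ≤ 1) :
    RlF (mct C t) 1 0 := by
  refine ⟨[⟨(t, C), by show C.card ≤ 2; omega, ht⟩], fun x => gate_apply_eq _ _, ?_, ?_⟩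
  · exact List.countP_le_length
  · have : C.card ≠ 2 := by omega
    simp [Gate.controls, this]

theorem RlF.gate2 {C : Finset (Fin n)} {t : Fin n} (ht : t ∉ C) (hC : C.card = 2) :
    RlF (mct C t) 0 1 := by
  refine ⟨[⟨(t, C), by show C.card ≤ 2; omega, ht⟩], fun x => gate_apply_eq _ _, ?_, ?_⟩
  · simp [Gate.controls, hC]
  · exact List.countP_le_length

theorem ladder (k : ℕ) : ∀ (C Z : Finset (Fin n)) (t : Fin n), C.card = k + 1 → Z.card = k →
    Disjoint C Z → t ∉ C → t ∉ Z →
    ∃ F G : (Fin n → Bool) → (Fin n → Bool), RlF F 1 (2 * k) ∧ RlF G 1 (2 * k) ∧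
      (∀ x, F x = fl t (al C x) (G x)) ∧ (∀ x, G (G x) = x) ∧
      (∀ w, w ∉ C → w ∉ Z → ∀ b x, G (fl w b x) = fl w b (G x)) ∧
      (∀ w, w ∉ Z → ∀ x, G x w = x w) := by
  induction k with
  | zero =>
    intro C Z t hC hZ hd htC htZ
    refine ⟨mct C t, fun x => x, ?_, ?_, fun x => rfl, fun x => rfl, fun _ _ _ _ _ => rfl,
      fun _ _ _ => rfl⟩
    · exact RlF.gate1 htC (by omega)
    · exact RlF.id.mono (by omega) (by omega)
  | succ k ih =>
    intro C Z t hC hZ hd htC htZ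
    obtain ⟨c, C', hc, rfl, hC'⟩ := Finset.card_eq_succ.1 hC
    obtain ⟨a, Z', ha, rfl, hZ'⟩ := Finset.card_eq_succ.1 hZ
    rw [Finset.disjoint_insert_left, Finset.disjoint_insert_right] at hd
    obtain ⟨hcZ, haC, hd⟩ := hd
    simp only [Finset.mem_insert, not_or] at htC htZ hcZ
    obtain ⟨F, G, hF, hG, h1, h2, h3, h4⟩ := ih C' Z' a hC' hZ' hd haC ha
    have hca : c ≠ a := hcZ.1
    have hT : RlF (mct {c, a} t) 0 1 := by
      apply RlF.gate2
      · simp; tauto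
      · exact Finset.card_pair hca
    have hTe : ∀ x, mct {c, a} t x = fl t (x c && x a) x := by
      intro x
      unfold mct al; congr 1; rw [Bool.eq_iff_iff]; simp
    have hCG : ∀ x, al C' (G x) = al C' x := fun x =>
      al_congr fun j hj => h4 j (Finset.disjoint_left.1 hd hj) x
    have hFt : ∀ w, w ∉ insert c C' → w ∉ insert a Z' → ∀ b x, F (fl w b x) = fl w b (F x) := by
      intro w hw hw' b x
      simp only [Finset.mem_insert, not_or] at hw hw'
      rw [h1, h1, al_fl hw.2, h3 w hw.2 hw'.2, fl_comm]
    refine ⟨fun x => mct {c, a} t (F (mct {c, a} t x)), F, ?_, ?_, ?_, ?_, hFt, ?_⟩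
    · exact (hT.comp (hF.comp hT)).mono (by omega) (by omega)
    · exact hF.mono (by omega) (by omega)
    · intro x
      simp only [hTe]
      rw [hFt t (by simp; tauto) (by simp; tauto), fl_fl, al_insert]
      congr 1
      have hFc : F x c = x c := by
        rw [h1, fl_ne hca, h4 c hcZ.2]
      have hFa : F x a = xor (x a) (al C' x) := by
        rw [h1, fl_same, h4 a ha]
      rw [fl_ne (by tauto), fl_ne (by tauto), hFc, hFa]
      cases x c <;> cases x a <;> simp
    · intro x
      rw [h1, h1, al_fl haC, hCG, h3 a haC ha, fl_fl, Bool.xor_self, fl_false, h2]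
    · intro w hw x
      simp only [Finset.mem_insert, not_or] at hw
      rw [h1, fl_ne hw.1, h4 w hw.2]

theorem mct_dirty {C Z : Finset (Fin n)} {t : Fin n} {k : ℕ} (hC : C.card = k + 1)
    (hZ : k ≤ Z.card) (hd : Disjoint C Z) (htC : t ∉ C) (htZ : t ∉ Z) :
    RlF (mct C t) 2 (4 * k) := by
  obtain ⟨Z', hZ', hk⟩ := Finset.exists_subset_card_eq hZ
  have hd' := Finset.disjoint_of_subset_right hZ' hd
  obtain ⟨F, G, hF, hG, h1, h2, h3, h4⟩ := ladder k C Z' t hC hk hd' htC (fun h => htZ (hZ' h))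
  refine ((hF.comp hG).congr fun x => ?_).mono (by omega) (by omega)
  rw [h1, h2, mct]
  congr 1
  exact al_congr fun j hj => (h4 j (Finset.disjoint_left.1 hd' hj) x).symm

theorem mct_real {C : Finset (Fin n)} {t d : Fin n} (hC : C.Nonempty) (htC : t ∉ C)
    (hdC : d ∉ C) (hdt : d ≠ t) : RlF (mct C t) 8 (8 * C.card) := by
  have hpos := hC.card_pos
  obtain ⟨A, hA, hAc⟩ := Finset.exists_subset_card_eq (s := C) (n := (C.card + 1) / 2) (by omega)
  set B := C \ A with hB
  have hBc : B.card = C.card - A.card := Finset.card_sdiff_of_subset hA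
  have hAB : Disjoint A B := Finset.disjoint_sdiff
  have hU : A ∪ B = C := Finset.union_sdiff_of_subset hA
  have hBC : B ⊆ C := Finset.sdiff_subset
  have hdB : d ∉ B := fun h => hdC (hBC h)
  have hdA : d ∉ A := fun h => hdC (hA h)
  have htB : t ∉ B := fun h => htC (hBC h)
  have htA : t ∉ A := fun h => htC (hA h)
  obtain ⟨k, hk⟩ : ∃ k, A.card = k + 1 := ⟨A.card - 1, by omega⟩
  have e1 : RlF (mct A d) 2 (4 * k) := mct_dirty hk (by omega) hAB hdA hdB
  have e2 : RlF (mct (insert d B) t) 2 (4 * B.card) :=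
    mct_dirty (Z := A) (by rw [Finset.card_insert_of_notMem hdB]) (by omega)
      (by rw [Finset.disjoint_insert_left]; exact ⟨hdA, hAB.symm⟩)
      (by simp; exact ⟨hdt.symm, htB⟩) htA
  refine ((e2.comp (e1.comp (e2.comp e1))).congr fun x => ?_).mono (by omega) (by omega)
  have hal : al C x = (al A x && al B x) := by
    rw [← hU]; unfold al; rw [Bool.eq_iff_iff]; simp [or_imp, forall_and]
  simp only [mct, al_insert, al_fl hdB, al_fl htB, al_fl hdA, al_fl htA, fl_same, fl_ne hdt]
  rw [fl_comm t d ((x d ^^ al A x) && al B x), fl_fl d, Bool.xor_self, fl_false, fl_fl, hal]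
  congr 1
  cases x d <;> cases al A x <;> cases al B x <;> rfl

/-- simultaneous flips -/
theorem flips (J : Finset (Fin n)) (b : Fin n → (Fin n → Bool) → Bool) (α : ℕ)
    (hb : ∀ j ∈ J, ∀ x y : Fin n → Bool, (∀ w, w ∉ J → x w = y w) → b j x = b j y)
    (hr : ∀ j ∈ J, RlF (fun x => fl j (b j x) x) α 0) :
    RlF (fun x w => if w ∈ J then xor (x w) (b w x) else x w) (J.card * α) 0 := by
  suffices H : ∀ I : Finset (Fin n), I ⊆ J →
      RlF (fun x w => if w ∈ I then xor (x w) (b w x) else x w) (I.card * α) 0 from H J le_rfl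
  intro I
  induction I using Finset.induction_on with
  | empty => intro _; exact (RlF.id.congr fun x => by simp).mono (by omega) (by omega)
  | insert i I hi ih =>
    intro hI
    have hiJ : i ∈ J := hI (Finset.mem_insert_self _ _)
    have hIJ : I ⊆ J := fun w hw => hI (Finset.mem_insert_of_mem hw)
    refine (((hr i hiJ).comp (ih hIJ)).congr fun x => ?_).mono ?_ (by omega)
    · funext w
      have hbi : b i (fun w => if w ∈ I then xor (x w) (b w x) else x w) = b i x := by
        apply hb i hiJ
        intro w hw
        have : w ∉ I := fun h => hw (hIJ h)
        simp [this]
      rw [hbi]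
      by_cases hw : w = i
      · subst hw; simp [fl, hi]
      · simp [fl, hw]
    · rw [Finset.card_insert_of_notMem hi]; ring_nf; omega

end RevCirc
namespace RevCirc
variable {n : ℕ}

/-- all coordinates outside `S` are one -/
def OO (S : Finset (Fin n)) (x : Fin n → Bool) : Prop := ∀ j, j ∉ S → x j = true

theorem subswap_aux {S : Finset (Fin n)} {t d : Fin n} (htS : t ∈ S) (hS : 2 ≤ S.card)
    (hd : d ∉ S) {x y : Fin n → Bool} (hx : OO S x) (hy : OO S y) (hxt : x t = false)
    (hyt : y t = true) :
    ∃ F, RlF F (4 * S.card + 8) (8 * S.card) ∧ F x = y ∧ F y = x ∧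
      ∀ z, OO S z → z ≠ x → z ≠ y → F z = z := by
  set J := S.erase t with hJ
  have hJc : J.card = S.card - 1 := Finset.card_erase_of_mem htS
  have htJ : t ∉ J := Finset.notMem_erase t S
  have hdJ : d ∉ J := fun h => hd (Finset.mem_of_mem_erase h)
  have hdt : d ≠ t := fun h => hd (h ▸ htS)
  have hM := flips J (fun j z => xor (!x j) (z t && xor (x j) (y j))) 2
    (by intro j _ z z' h; simp [h t htJ])
    (by
      intro j hj
      have hjt : t ≠ j := fun h => htJ (h ▸ hj)
      have r1 : RlF (fun z : Fin n → Bool => fl j (!x j) z) 1 0 := by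
        cases x j
        · exact (RlF.gate1 (C := ∅) (t := j) (by simp) (by simp)).congr fun z => by
            simp [mct, al_empty]
        · exact (RlF.id.congr fun z => by simp [fl_false]).mono (by omega) (by omega)
      have r2 : RlF (fun z : Fin n → Bool => fl j (z t && xor (x j) (y j)) z) 1 0 := by
        cases xor (x j) (y j)
        · exact (RlF.id.congr fun z => by simp [fl_false]).mono (by omega) (by omega)
        · exact (RlF.gate1 (C := {t}) (t := j) (by simp [hjt.symm]) (by simp)).congr fun z => by
            simp [mct, al]
      exact (r1.comp r2).congr fun z => by rw [fl_fl]; congr 1; rw [Bool.xor_comm])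
  set M := (fun (z : Fin n → Bool) w => if w ∈ J then
    xor (z w) (xor (!x w) (z t && xor (x w) (y w))) else z w) with hMdef
  obtain ⟨N, hN, hNM, hMN⟩ := hM.inv
  have hC := mct_real (C := J) (t := t) (d := d) (Finset.card_pos.1 (by omega)) htJ hdJ hdt
  have hMt : ∀ z, M z t = z t := fun z => by simp [hMdef, htJ]
  have hMo : ∀ z, OO S z → OO S (M z) := by
    intro z hz j hj
    have : j ∉ J := fun h => hj (Finset.mem_of_mem_erase h)
    simp [hMdef, this, hz j hj]
  have hMx : ∀ j ∈ J, M x j = true := by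
    intro j hj; simp only [hMdef, hj, if_true, hxt]; cases x j <;> rfl
  have hMy : ∀ j ∈ J, M y j = true := by
    intro j hj; simp only [hMdef, hj, if_true, hyt]; cases x j <;> cases y j <;> rfl
  have hSJ : ∀ j, j ∈ S → j ≠ t → j ∈ J := fun j h h' => Finset.mem_erase.2 ⟨h', h⟩
  -- a point with ones on `J` and off `S` is determined by its value at `t`
  have hdet : ∀ u v, OO S u → OO S v → (∀ j ∈ J, u j = true) → (∀ j ∈ J, v j = true) →
      u t = v t → u = v := by
    intro u v hu hv hu' hv' h
    funext j
    by_cases hjS : j ∈ S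
    · by_cases hjt : j = t
      · rw [hjt, h]
      · rw [hu' j (hSJ j hjS hjt), hv' j (hSJ j hjS hjt)]
    · rw [hu j hjS, hv j hjS]
  have alx : al J (M x) = true := by simpa [al] using hMx
  have aly : al J (M y) = true := by simpa [al] using hMy
  have hflo : ∀ u b, OO S u → OO S (fl t b u) := by
    intro u b hu j hj
    rw [fl_ne (fun h => hj (by rw [h]; exact htS))]; exact hu j hj
  have hflJ : ∀ (u : Fin n → Bool) (b : Bool), (∀ j ∈ J, u j = true) → ∀ j ∈ J, fl t b u j = true := by
    intro u b hu j hj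
    rw [fl_ne (fun h => htJ (by rw [← h]; exact hj))]; exact hu j hj
  have hxy : mct J t (M x) = M y := by
    rw [mct, alx]
    exact hdet _ _ (hflo _ _ (hMo _ hx)) (hMo _ hy) (hflJ _ _ hMx) hMy
      (by rw [fl_same, hMt, hMt, hxt, hyt]; rfl)
  refine ⟨fun z => N (mct J t (M z)), (hN.comp (hC.comp hM)).mono (by omega) (by omega), ?_, ?_, ?_⟩
  · show N (mct J t (M x)) = y
    rw [hxy, hNM]
  · show N (mct J t (M y)) = x
    rw [← hxy, mct_mct htJ, hNM]
  · intro z hz hzx hzy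
    show N (mct J t (M z)) = z
    have : al J (M z) = false := by
      by_contra hc
      have hz1 : ∀ j ∈ J, M z j = true := by simpa [al] using hc
      cases hzt : z t
      · apply hzx
        rw [← hNM z, ← hNM x]; congr 1
        exact hdet _ _ (hMo _ hz) (hMo _ hx) hz1 hMx (by rw [hMt, hMt, hzt, hxt])
      · apply hzy
        rw [← hNM z, ← hNM y]; congr 1
        exact hdet _ _ (hMo _ hz) (hMo _ hy) hz1 hMy (by rw [hMt, hMt, hzt, hyt])
    rw [mct, this, fl_false, hNM]

theorem subswap {S : Finset (Fin n)} {d : Fin n} (hS : 2 ≤ S.card)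
    (hd : d ∉ S) {x y : Fin n → Bool} (hx : OO S x) (hy : OO S y) (hxy : x ≠ y) :
    ∃ F, RlF F (4 * S.card + 8) (8 * S.card) ∧ F x = y ∧ F y = x ∧
      ∀ z, OO S z → z ≠ x → z ≠ y → F z = z := by
  obtain ⟨t, ht⟩ := Function.ne_iff.1 hxy
  have htS : t ∈ S := by
    by_contra h; exact ht (by rw [hx t h, hy t h])
  cases h1 : x t
  · have h2 : y t = true := by rw [h1] at ht; cases h : y t <;> simp_all
    exact subswap_aux htS hS hd hx hy h1 h2
  · have h2 : y t = false := by rw [h1] at ht; cases h : y t <;> simp_all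
    obtain ⟨F, h, a, b, c⟩ := subswap_aux htS hS hd hy hx h2 h1
    exact ⟨F, h, b, a, fun z hz h1 h2 => c z hz h2 h1⟩

theorem place {U : Type*} [DecidableEq U] {S : Finset (Fin n)} {d : Fin n}
    (hS : 2 ≤ S.card) (hd : d ∉ S) (p q : U → Fin n → Bool) (hp : Function.Injective p)
    (hq : Function.Injective q) (hpo : ∀ u, OO S (p u)) (hqo : ∀ u, OO S (q u)) (V : Finset U) :
    ∃ F, RlF F (V.card * (4 * S.card + 8)) (V.card * (8 * S.card)) ∧ (∀ u ∈ V, F (p u) = q u) ∧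
      ∀ z, OO S z → OO S (F z) := by
  induction V using Finset.induction_on with
  | empty => exact ⟨fun x => x, RlF.id.mono (by omega) (by omega), by simp, fun z hz => hz⟩
  | insert v V hv ih =>
    obtain ⟨F, hF, h1, h2⟩ := ih
    have c1 : V.card * (4 * S.card + 8) ≤ (insert v V).card * (4 * S.card + 8) :=
      Nat.mul_le_mul_right _ (Finset.card_le_card (Finset.subset_insert _ _))
    have c2 : V.card * (8 * S.card) ≤ (insert v V).card * (8 * S.card) :=
      Nat.mul_le_mul_right _ (Finset.card_le_card (Finset.subset_insert _ _))
    by_cases he : F (p v) = q v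
    · refine ⟨F, hF.mono c1 c2, ?_, h2⟩
      intro u hu
      rcases Finset.mem_insert.1 hu with rfl | hu
      · exact he
      · exact h1 u hu
    · obtain ⟨G, hG, g1, g2, g3⟩ := subswap hS hd (h2 _ (hpo v)) (hqo v) he
      refine ⟨fun z => G (F z), (hG.comp hF).mono ?_ ?_, ?_, ?_⟩
      · rw [Finset.card_insert_of_notMem hv]; ring_nf; omega
      · rw [Finset.card_insert_of_notMem hv]; ring_nf; omega
      · intro u hu
        rcases Finset.mem_insert.1 hu with rfl | hu
        · exact g1
        · have huv : u ≠ v := fun h => hv (h ▸ hu)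
          show G (F (p u)) = q u
          rw [g3 _ (h2 _ (hpo u))]
          · exact h1 u hu
          · exact fun h => huv (hp (hF.inj h))
          · rw [h1 u hu]; exact fun h => huv (hq h)
      · intro z hz
        have hz' := h2 z hz
        by_cases e1 : F z = F (p v)
        · show OO S (G (F z)); rw [e1, g1]; exact hqo v
        · by_cases e2 : F z = q v
          · show OO S (G (F z)); rw [e2, g2]; exact h2 _ (hpo v)
          · show OO S (G (F z)); rw [g3 _ hz' e1 e2]; exact hz'

/-- the first stage: make all but few coordinates equal to one on the given points -/
theorem stageA {U : Type*} [Fintype U] [DecidableEq U] (p : U → Fin n → Bool) :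
    ∃ (S : Finset (Fin n)) (F : (Fin n → Bool) → (Fin n → Bool)),
      S.card ≤ 2 ^ Fintype.card U ∧ RlF F n 0 ∧ ∀ u, OO S (F (p u)) := by
  classical
  let row : Fin n → (U → Bool) := fun j u => p u j
  have hrep : ∀ v : Set.range row, ∃ j, row j = v.1 := fun v => v.2
  choose f hf using hrep
  let rep : Fin n → Fin n := fun j => f ⟨row j, j, rfl⟩
  have hrow : ∀ j, row (rep j) = row j := fun j => hf ⟨row j, j, rfl⟩
  let S : Finset (Fin n) := Finset.univ.image rep
  have hrS : ∀ j, rep j ∈ S := fun j => Finset.mem_image_of_mem _ (Finset.mem_univ j)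
  have r1 := flips S (fun _ _ => true) 1 (by intros; rfl) (by
    intro j _
    exact (RlF.gate1 (C := ∅) (t := j) (by simp) (by simp)).congr fun z => by
            simp [mct, al_empty])
  have r2 := flips Sᶜ (fun j z => z (rep j)) 1
    (by intro j _ x y h; exact h _ (by simpa using hrS j)) (by
    intro j hj
    have : j ∉ ({rep j} : Finset (Fin n)) := by
      rw [Finset.mem_singleton]; intro h
      rw [Finset.mem_compl] at hj
      exact hj (by rw [h]; exact hrS j)
    exact (RlF.gate1 (C := {rep j}) (t := j) this (by simp)).congr fun z => by
            simp [mct, al])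
  refine ⟨S, _, ?_, (r2.comp r1).mono ?_ (by omega), ?_⟩
  · have hinj : S.card ≤ (Finset.univ : Finset (U → Bool)).card := by
      apply Finset.card_le_card_of_injOn row (fun _ _ => Finset.mem_coe.2 (Finset.mem_univ _))
      intro a ha b hb hab
      obtain ⟨i, _, rfl⟩ := Finset.mem_image.1 (Finset.mem_coe.1 ha)
      obtain ⟨j, _, rfl⟩ := Finset.mem_image.1 (Finset.mem_coe.1 hb)
      rw [hrow, hrow] at hab
      show f _ = f _
      congr 1
      exact Subtype.ext hab
    simpa using hinj
  · rw [mul_one, mul_one, Finset.card_compl, Fintype.card_fin]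
    have : S.card ≤ n := by simpa using Finset.card_le_univ S
    omega
  · intro u j hj
    have h1 : j ∈ Sᶜ := Finset.mem_compl.2 hj
    have h2 : p u (rep j) = p u j := congrFun (hrow j) u
    simp only [h1, if_true, hj, if_false, hrS j, h2]
    cases p u j <;> rfl

/-- cost overhead -/
def E (s : ℕ) : ℕ := 2 * (2 ^ (s + 1) * (8 * (2 ^ 2 ^ (s + 1) + 2 ^ (s + 1)) + 8)) + 8

theorem group {s : ℕ} (hs : 1 ≤ s) (hn : 2 ^ 2 ^ (s + 1) + 2 ^ (s + 1) < n)
    (p : (Fin (s + 1) → Bool) → Fin n → Bool) (hp : Function.Injective p)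
    (g : (Fin n → Bool) → Fin n → Bool)
    (hg : ∀ u, g (p u) = p (Function.update u 0 (!u 0)))
    (hg' : ∀ z, z ∉ Set.range p → g z = z) :
    RlF g (2 * n + E s) (8 * n + E s) := by
  classical
  have hs2 : s + 1 < 2 ^ (s + 1) := Nat.lt_two_pow_self
  have hpp : 0 < 2 ^ 2 ^ (s + 1) := by positivity
  have hsn : s + 1 < n := by omega
  obtain ⟨S0, A, hS0, hA, hAo⟩ := stageA p
  have hU : Fintype.card (Fin (s + 1) → Bool) = 2 ^ (s + 1) := by simp
  rw [hU] at hS0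
  let W : Finset (Fin n) := Finset.univ.filter fun j => (j : ℕ) < s + 1
  have hW : W.card = s + 1 := by
    have : W = Finset.univ.map (Fin.castLEEmb hsn.le) := by
      ext j; simp only [W, Finset.mem_filter, Finset.mem_univ, true_and, Finset.mem_map]
      constructor
      · intro h; exact ⟨⟨j, h⟩, by ext; rfl⟩
      · rintro ⟨i, rfl⟩; exact i.2
    rw [this]; simp
  let S := S0 ∪ W
  have hSc : S.card ≤ 2 ^ 2 ^ (s + 1) + 2 ^ (s + 1) := by
    have := Finset.card_union_le S0 W
    show (S0 ∪ W).card ≤ _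
    omega
  have hS2 : 2 ≤ S.card := by
    have : W.card ≤ S.card := Finset.card_le_card Finset.subset_union_right
    omega
  obtain ⟨d, hd⟩ : ∃ d, d ∉ S := by
    by_contra! h
    have : S = Finset.univ := Finset.eq_univ_iff_forall.2 h
    rw [this, Finset.card_univ, Fintype.card_fin] at hSc
    omega
  let q : (Fin (s + 1) → Bool) → Fin n → Bool := fun u j =>
    if h : (j : ℕ) < s + 1 then u ⟨j, h⟩ else true
  have hqi : ∀ u (i : Fin (s + 1)), q u ⟨i, i.2.trans hsn⟩ = u i := by
    intro u i; exact dif_pos i.2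
  have hq1 : ∀ u (j : Fin n) (h : (j : ℕ) < s + 1), q u j = u ⟨j, h⟩ := fun u j h => dif_pos h
  have hq2 : ∀ u (j : Fin n), ¬ (j : ℕ) < s + 1 → q u j = true := fun u j h => dif_neg h
  have hq : Function.Injective q := by
    intro u v h; funext i
    rw [← hqi u i, ← hqi v i, h]
  obtain ⟨P, hP, hPe, -⟩ := place hS2 hd (fun u => A (p u)) q (fun u v h => hp (hA.inj h)) hq
    (fun u j hj => hAo u j (fun h => hj (Finset.mem_union_left _ h)))
    (fun u j hj => by
      have : ¬ (j : ℕ) < s + 1 := fun h => hj (Finset.mem_union_right _ (by simp only [W, Finset.mem_filter, Finset.mem_univ, true_and]; exact h))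
      exact hq2 u j this) Finset.univ
  rw [Finset.card_univ, hU] at hP
  have hσ := hP.comp hA
  obtain ⟨τ, hτ, t1, t2⟩ := hσ.inv
  have t1 : ∀ x, τ (P (A x)) = x := t1
  have t2 : ∀ x, P (A (τ x)) = x := t2
  let t0 : Fin n := ⟨0, by omega⟩
  let d0 : Fin n := ⟨1, by omega⟩
  have htW : t0 ∉ Wᶜ := by simp [W, t0]
  have hWn : Wᶜ.card = n - (s + 1) := by rw [Finset.card_compl, hW, Fintype.card_fin]
  have hcore : RlF (mct Wᶜ t0) 8 (8 * n) :=
    (mct_real (d := d0) (Finset.card_pos.1 (by omega)) htW (by simp [W, d0]; omega)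
      (by simp [t0, d0])).mono le_rfl (by omega)
  have alq : ∀ u, al Wᶜ (q u) = true := by
    intro u; simp only [al, decide_eq_true_eq]
    intro j hj
    have : ¬ (j : ℕ) < s + 1 := by simpa [W] using hj
    exact hq2 u j this
  have hcq : ∀ u, mct Wᶜ t0 (q u) = q (Function.update u 0 (!u 0)) := by
    intro u
    rw [mct, alq]
    funext j
    by_cases hj : j = t0
    · subst hj
      rw [fl_same]
      have h1 := hqi u 0
      have h2 := hqi (Function.update u 0 (!u 0)) 0
      have h3 : t0 = ⟨((0 : Fin (s+1)) : ℕ), (0 : Fin (s+1)).2.trans hsn⟩ := by ext; simp [t0]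
      rw [h3, h1, h2]; simp
    · rw [fl_ne hj]
      by_cases h : (j : ℕ) < s + 1
      · have h0 : (⟨j, h⟩ : Fin (s + 1)) ≠ 0 := by
          intro h'; apply hj; ext; simpa [t0] using congrArg Fin.val h'
        rw [hq1 _ _ h, hq1 _ _ h, Function.update_of_ne h0]
      · rw [hq2 _ _ h, hq2 _ _ h]
  have hPq : ∀ u, P (A (p u)) = q u := fun u => hPe u (Finset.mem_univ u)
  refine ((hτ.comp (hcore.comp hσ)).congr fun z => ?_).mono ?_ ?_
  · by_cases hz : z ∈ Set.range p
    · obtain ⟨u, rfl⟩ := hz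
      rw [hg, hPq, hcq, ← hPq, t1]
    · rw [hg' z hz]
      have : al Wᶜ (P (A z)) = false := by
        by_contra hc
        apply hz
        have hc : ∀ j ∈ Wᶜ, P (A z) j = true := by simpa [al] using hc
        let u0 : Fin (s + 1) → Bool := fun i => P (A z) ⟨i.1, lt_trans i.2 hsn⟩
        have hqz : q u0 = P (A z) := by
          funext j
          by_cases h : (j : ℕ) < s + 1
          · exact hq1 u0 j h
          · exact (hq2 u0 j h).trans (hc j (by simp [W]; omega)).symm
        exact ⟨u0, by rw [← t1 z, ← hqz, ← hPq, t1]⟩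
      rw [mct, this, fl_false, t1]
  · have : 2 ^ (s + 1) * (4 * S.card + 8) ≤
        2 ^ (s + 1) * (8 * (2 ^ 2 ^ (s + 1) + 2 ^ (s + 1)) + 8) :=
      Nat.mul_le_mul_left _ (by omega)
    unfold E; omega
  · have : 2 ^ (s + 1) * (8 * S.card) ≤
        2 ^ (s + 1) * (8 * (2 ^ 2 ^ (s + 1) + 2 ^ (s + 1)) + 8) :=
      Nat.mul_le_mul_left _ (by omega)
    unfold E; omega

end RevCirc
namespace RevCirc
variable {n : ℕ}

theorem two_invol {X : Type*} (h : Equiv.Perm X) :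
    ∃ a b : Equiv.Perm X, h = a * b ∧ a * a = 1 ∧ b * b = 1 := by
  classical
  let st : Setoid X := Equiv.Perm.SameCycle.setoid h
  let r : X → X := fun x => (Quotient.mk st x).out
  have hr : ∀ x, ∃ i : ℤ, (h ^ i) (r x) = x := fun x =>
    (Quotient.mk_out (s := st) x : h.SameCycle _ _)
  have hrr : ∀ x (i : ℤ), r ((h ^ i) x) = r x := by
    intro x i
    show (Quotient.mk st _).out = (Quotient.mk st _).out
    congr 1
    apply Quotient.sound
    show h.SameCycle _ _
    exact ⟨-i, by rw [← Equiv.Perm.mul_apply, ← zpow_add]; simp⟩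
  have hr0 : ∀ x, r (r x) = r x := by
    intro x
    obtain ⟨i, hi⟩ := hr x
    conv_rhs => rw [← hi, hrr]
  choose e he using hr
  -- the reflection
  let f : X → X := fun x => (h ^ (- e x)) (r x)
  have key : ∀ x (i : ℤ), f ((h ^ i) (r x)) = (h ^ (-i)) (r x) := by
    intro x i
    have h1 : r ((h ^ i) (r x)) = r x := by rw [hrr, hr0]
    have h2 := he ((h ^ i) (r x))
    rw [h1] at h2
    show (h ^ (- e ((h ^ i) (r x)))) (r ((h ^ i) (r x))) = _
    rw [h1]
    set j := e ((h ^ i) (r x)) with hj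
    have h3 : (h ^ (-i - j)) ((h ^ j) (r x)) = (h ^ (-i - j)) ((h ^ i) (r x)) := by rw [h2]
    rw [← Equiv.Perm.mul_apply, ← Equiv.Perm.mul_apply, ← zpow_add, ← zpow_add] at h3
    rw [show -i - j + i = -j by ring, show -i - j + j = -i by ring] at h3
    exact h3.symm
  have hff : Function.Involutive f := by
    intro x
    show f ((h ^ (- e x)) (r x)) = x
    rw [key, neg_neg, he]
  have hhf : ∀ x, h (f (h (f x))) = x := by
    intro x
    have h1 : h (f x) = (h ^ (1 - e x)) (r x) := by
      show h ((h ^ (- e x)) (r x)) = _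
      rw [sub_eq_add_neg, zpow_add, zpow_one]; rfl
    rw [h1, key]
    have : h ((h ^ (-(1 - e x))) (r x)) = (h ^ (1 + -(1 - e x))) (r x) := by
      rw [zpow_add, zpow_one]; rfl
    rw [this, show 1 + -(1 - e x) = e x by ring, he]
  let b : Equiv.Perm X := hff.toPerm f
  have hb : b * b = 1 := by
    ext x; exact hff x
  refine ⟨h * b, b, ?_, ?_, hb⟩
  · rw [mul_assoc, hb, mul_one]
  · ext x; exact hhf x

section
set_option linter.unusedSectionVars false
variable {X : Type*} [Fintype X] [DecidableEq X]

theorem inv_app {a : Equiv.Perm X} (ha : a * a = 1) (x : X) : a (a x) = x := by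
  rw [← Equiv.Perm.mul_apply, ha]; rfl

theorem reps (a : Equiv.Perm X) (ha : a * a = 1) :
    ∃ R : Finset X, (∀ x ∈ R, a x ∉ R) ∧ ∀ x, x ∈ a.support ↔ x ∈ R ∨ a x ∈ R := by
  let o := Fintype.equivFin X
  refine ⟨Finset.univ.filter fun x => o x < o (a x), ?_, ?_⟩
  · intro x hx hx'
    simp only [Finset.mem_filter, Finset.mem_univ, true_and] at hx hx'
    rw [inv_app ha] at hx'
    exact lt_asymm hx hx'
  · intro x
    simp only [Finset.mem_filter, Finset.mem_univ, true_and, Equiv.Perm.mem_support, inv_app ha]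
    constructor
    · intro h
      have : o x ≠ o (a x) := fun h' => h (o.injective h').symm
      exact lt_or_gt_of_ne this
    · rintro (h | h) h' <;> (rw [h'] at h; exact lt_irrefl _ h)

theorem card_RR (a : Equiv.Perm X) (R : Finset X) (hR : ∀ x ∈ R, a x ∉ R) :
    (R ∪ R.image a).card = 2 * R.card := by
  rw [Finset.card_union_of_disjoint, Finset.card_image_of_injective _ a.injective]
  · ring
  · rw [Finset.disjoint_right]
    intro y hy
    obtain ⟨x, hx, rfl⟩ := Finset.mem_image.1 hy
    exact hR x hx

theorem supp_RR (a : Equiv.Perm X) (ha : a * a = 1) (R : Finset X)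
    (h : ∀ x, x ∈ a.support ↔ x ∈ R ∨ a x ∈ R) : a.support = R ∪ R.image a := by
  ext x
  rw [h, Finset.mem_union, Finset.mem_image]
  apply or_congr Iff.rfl
  constructor
  · intro hx; exact ⟨a x, hx, inv_app ha x⟩
  · rintro ⟨y, hy, rfl⟩; rwa [inv_app ha]

theorem subinv (a : Equiv.Perm X) (ha : a * a = 1) (K : ℕ) (hK : 2 * K ≤ a.support.card) :
    ∃ g r : Equiv.Perm X, a = g * r ∧ g * g = 1 ∧ r * r = 1 ∧ g.support.card = 2 * K ∧
      r.support.card + 2 * K = a.support.card := by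
  obtain ⟨R, hR1, hR2⟩ := reps a ha
  have hs := supp_RR a ha R hR2
  have hc : a.support.card = 2 * R.card := by rw [hs, card_RR a R hR1]
  obtain ⟨R', hR', hK'⟩ := Finset.exists_subset_card_eq (s := R) (n := K) (by omega)
  have hR1' : ∀ x ∈ R', a x ∉ R' := fun x hx h => hR1 x (hR' hx) (hR' h)
  let Q := R' ∪ R'.image a
  have hQc : Q.card = 2 * K := by rw [card_RR a R' hR1', hK']
  have hQa : ∀ x, a x ∈ Q ↔ x ∈ Q := by
    have : ∀ x, x ∈ Q → a x ∈ Q := by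
      intro x hx
      rcases Finset.mem_union.1 hx with h | h
      · exact Finset.mem_union_right _ (Finset.mem_image_of_mem _ h)
      · obtain ⟨y, hy, rfl⟩ := Finset.mem_image.1 h
        rw [inv_app ha]; exact Finset.mem_union_left _ hy
    intro x
    exact ⟨fun h => by have := this _ h; rwa [inv_app ha] at this, this x⟩
  have hQs : Q ⊆ a.support := by
    rw [hs]; exact Finset.union_subset_union hR' (Finset.image_subset_image hR')
  have i1 : Function.Involutive fun x => if x ∈ Q then a x else x := by
    intro x
    by_cases h : x ∈ Q <;> simp [h, hQa, inv_app ha]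
  have i2 : Function.Involutive fun x => if x ∈ Q then x else a x := by
    intro x
    by_cases h : x ∈ Q <;> simp [h, hQa, inv_app ha]
  have g1 : ∀ x, i1.toPerm _ x = if x ∈ Q then a x else x := fun _ => rfl
  have g2 : ∀ x, i2.toPerm _ x = if x ∈ Q then x else a x := fun _ => rfl
  have s1 : (i1.toPerm _).support = Q := by
    ext x
    rw [Equiv.Perm.mem_support, g1]
    by_cases h : x ∈ Q
    · simp [h, Equiv.Perm.mem_support.1 (hQs h)]
    · simp [h]
  have s2 : (i2.toPerm _).support = a.support \ Q := by
    ext x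
    rw [Equiv.Perm.mem_support, g2, Finset.mem_sdiff, Equiv.Perm.mem_support]
    by_cases h : x ∈ Q <;> simp [h]
  refine ⟨i1.toPerm _, i2.toPerm _, ?_, ?_, ?_, ?_, ?_⟩
  · ext x
    rw [Equiv.Perm.mul_apply, g2, g1]
    by_cases h : x ∈ Q <;> simp [h, hQa]
  · ext x; exact i1 x
  · ext x; exact i2 x
  · rw [s1, hQc]
  · rw [s2, Finset.card_sdiff_of_subset hQs, hQc]; omega

theorem sign_inv (a : Equiv.Perm X) (ha : a * a = 1) :
    ∃ m, a.support.card = 2 * m ∧ Equiv.Perm.sign a = (-1) ^ m := by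
  have h2 : a ^ 2 = 1 := by rw [sq, ha]
  have h3 : ∀ c ∈ a.cycleType, c = 2 := (Equiv.Perm.pow_prime_eq_one_iff (p := 2)).1 h2
  have h4 := Multiset.eq_replicate_card.2 h3
  have h5 := Equiv.Perm.sum_cycleType a
  have h6 := Equiv.Perm.sign_of_cycleType a
  set m := a.cycleType.card with hm
  rw [h4, Multiset.sum_replicate, smul_eq_mul] at h5
  rw [Equiv.Perm.sum_cycleType, ← h5] at h6
  refine ⟨m, by omega, ?_⟩
  rw [h6, pow_add, pow_mul']; simp
end

theorem group_inv {s : ℕ} (hs : 1 ≤ s) (hn : 2 ^ 2 ^ (s + 1) + 2 ^ (s + 1) < n)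
    (g : Equiv.Perm (Fin n → Bool)) (hg : g * g = 1) (hc : g.support.card = 2 * 2 ^ s) :
    RlF g (2 * n + E s) (8 * n + E s) := by
  obtain ⟨R, hR1, hR2⟩ := reps g hg
  have hS := supp_RR g hg R hR2
  have hRc : Fintype.card (Fin s → Bool) = Fintype.card R := by
    have := card_RR g R hR1
    rw [← hS, hc] at this
    simp; omega
  let e : (Fin s → Bool) ≃ R := Fintype.equivOfCardEq hRc
  let p : (Fin (s + 1) → Bool) → Fin n → Bool := fun u =>
    if u 0 then g (e (Fin.tail u)) else e (Fin.tail u)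
  have hpt : ∀ u, u 0 = true → p u = g (e (Fin.tail u)) := fun u h => by simp [p, h]
  have hpf : ∀ u, u 0 = false → p u = e (Fin.tail u) := fun u h => by simp [p, h]
  have hfin : ∀ u v : Fin (s + 1) → Bool, u 0 = v 0 → Fin.tail u = Fin.tail v → u = v := by
    intro u v h1 h2
    rw [← Fin.cons_self_tail u, ← Fin.cons_self_tail v, h1, h2]
  apply group hs hn p
  · intro u v huv
    cases hu : u 0 <;> cases hv : v 0
    · rw [hpf u hu, hpf v hv] at huv
      exact hfin _ _ (by rw [hu, hv]) (e.injective (Subtype.ext huv))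
    · rw [hpf u hu, hpt v hv] at huv
      exact absurd (huv ▸ (e (Fin.tail u)).2) (hR1 _ (e (Fin.tail v)).2)
    · rw [hpt u hu, hpf v hv] at huv
      exact absurd (huv ▸ (e (Fin.tail v)).2) (hR1 _ (e (Fin.tail u)).2)
    · rw [hpt u hu, hpt v hv] at huv
      exact hfin _ _ (by rw [hu, hv]) (e.injective (Subtype.ext (g.injective huv)))
  · intro u
    have ht : Fin.tail (Function.update u 0 (!u 0)) = Fin.tail u := Fin.tail_update_zero u _
    cases hu : u 0
    · rw [hpf u hu, hpt _ (by simp)]; rw [hu] at ht; rw [ht]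
    · rw [hpt u hu, hpf _ (by simp)]; rw [hu] at ht; rw [ht, inv_app hg]
  · intro z hz
    by_contra h
    have hz' := (hR2 z).1 (Equiv.Perm.mem_support.2 h)
    apply hz
    rcases hz' with h1 | h1
    · refine ⟨Fin.cons false (e.symm ⟨z, h1⟩), ?_⟩
      rw [hpf _ (by simp), Fin.tail_cons]; simp
    · refine ⟨Fin.cons true (e.symm ⟨g z, h1⟩), ?_⟩
      rw [hpt _ (by simp), Fin.tail_cons]; simp [inv_app hg]

theorem chunk {s : ℕ} (hs : 1 ≤ s) (hn : 2 ^ 2 ^ (s + 1) + 2 ^ (s + 1) < n) (N : ℕ) :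
    ∀ (a : Equiv.Perm (Fin n → Bool)), a * a = 1 → a.support.card = N →
    ∃ (G r : Equiv.Perm (Fin n → Bool)), a = G * r ∧ r * r = 1 ∧
      Equiv.Perm.sign G = 1 ∧ r.support.card < 2 * 2 ^ s ∧
      RlF G (N / (2 * 2 ^ s) * (2 * n + E s)) (N / (2 * 2 ^ s) * (8 * n + E s)) := by
  induction N using Nat.strong_induction_on with
  | _ N ih =>
  intro a ha hN
  have hpos : 0 < 2 * 2 ^ s := by positivity
  by_cases hlt : N < 2 * 2 ^ s
  · refine ⟨1, a, by simp, ha, by simp, by omega, ?_⟩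
    exact (RlF.id.congr fun x => by simp).mono (by omega) (by omega)
  · push Not at hlt
    obtain ⟨g, r, h1, h2, h3, h4, h5⟩ := subinv a ha (2 ^ s) (by omega)
    obtain ⟨G, r', k1, k2, k3, k4, k5⟩ := ih (N - 2 * 2 ^ s) (by omega) r h3 (by omega)
    refine ⟨g * G, r', by rw [h1, k1, mul_assoc], k2, ?_, k4, ?_⟩
    · obtain ⟨m, m1, m2⟩ := sign_inv g h2
      have : m = 2 ^ s := by omega
      rw [map_mul, k3, mul_one, m2, this]
      exact Even.neg_one_pow (Nat.even_pow.2 ⟨even_two, by omega⟩)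
    · have hq : N / (2 * 2 ^ s) = (N - 2 * 2 ^ s) / (2 * 2 ^ s) + 1 :=
        Nat.div_eq_sub_div hpos hlt
      refine (((group_inv hs hn g h2 h4).comp k5).congr fun x => rfl).mono ?_ ?_
      · rw [hq]; ring_nf; omega
      · rw [hq]; ring_nf; omega

theorem chunk2 {s : ℕ} (hs : 1 ≤ s) (hn : 2 ^ 2 ^ (s + 1) + 2 ^ (s + 1) < n)
    (a : Equiv.Perm (Fin n → Bool)) (ha : a * a = 1) :
    ∃ (G r : Equiv.Perm (Fin n → Bool)), a = G * r ∧ r * r = 1 ∧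
      Equiv.Perm.sign G = 1 ∧ r.support.card < 4 ∧
      RlF G (2 ^ n / (2 * 2 ^ s) * (2 * n + E s) + 2 ^ s * (2 * n + E 1))
        (2 ^ n / (2 * 2 ^ s) * (8 * n + E s) + 2 ^ s * (8 * n + E 1)) := by
  have hn1 : 2 ^ 2 ^ (1 + 1) + 2 ^ (1 + 1) < n := by
    have h1 : 2 ^ (1 + 1) ≤ 2 ^ (s + 1) := Nat.pow_le_pow_right (by omega) (by omega)
    have h2 : 2 ^ 2 ^ (1 + 1) ≤ 2 ^ 2 ^ (s + 1) := Nat.pow_le_pow_right (by omega) h1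
    omega
  obtain ⟨G, r, h1, h2, h3, h4, h5⟩ := chunk hs hn _ a ha rfl
  obtain ⟨G', r', k1, k2, k3, k4, k5⟩ := chunk le_rfl hn1 _ r h2 rfl
  refine ⟨G * G', r', by rw [h1, k1, mul_assoc], k2, by rw [map_mul, h3, k3, mul_one],
    by simpa using k4, ?_⟩
  have ca : a.support.card ≤ 2 ^ n := by simpa using Finset.card_le_univ a.support
  have c1 : a.support.card / (2 * 2 ^ s) ≤ 2 ^ n / (2 * 2 ^ s) := Nat.div_le_div_right ca
  have c2 : r.support.card / (2 * 2 ^ 1) ≤ 2 ^ s := by omega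
  exact ((h5.comp k5).congr fun x => rfl).mono
    (Nat.add_le_add (Nat.mul_le_mul_right _ c1) (Nat.mul_le_mul_right _ c2))
    (Nat.add_le_add (Nat.mul_le_mul_right _ c1) (Nat.mul_le_mul_right _ c2))

theorem swaps_disj (hn : 20 < n) (a b c d : Fin n → Bool) (hab : a ≠ b) (hcd : c ≠ d)
    (hac : a ≠ c) (had : a ≠ d) (hbc : b ≠ c) (hbd : b ≠ d) :
    RlF ⇑(Equiv.swap a b * Equiv.swap c d) (2 * n + E 1) (8 * n + E 1) := by
  have hdis : (Equiv.swap a b).Disjoint (Equiv.swap c d) := by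
    rw [Equiv.Perm.disjoint_iff_disjoint_support, Equiv.Perm.support_swap hab,
      Equiv.Perm.support_swap hcd]
    simp
    tauto
  apply group_inv le_rfl (by norm_num; exact hn)
  · have := hdis.commute.eq
    calc Equiv.swap a b * Equiv.swap c d * (Equiv.swap a b * Equiv.swap c d)
        = Equiv.swap a b * Equiv.swap c d * (Equiv.swap c d * Equiv.swap a b) := by rw [← this]
      _ = 1 := by simp [mul_assoc]
  · rw [hdis.card_support_mul, Equiv.Perm.card_support_swap hab, Equiv.Perm.card_support_swap hcd]
    norm_num

theorem swaps_two (hn : 20 < n) (u v : Equiv.Perm (Fin n → Bool)) (hu : u.IsSwap) (hv : v.IsSwap) :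
    RlF ⇑(u * v) (2 * (2 * n + E 1)) (2 * (8 * n + E 1)) := by
  obtain ⟨a, b, hab, rfl⟩ := hu
  obtain ⟨c, d, hcd, rfl⟩ := hv
  have hbig : 2 ^ 20 ≤ 2 ^ n := Nat.pow_le_pow_right (by omega) hn.le
  have hcardU : (Finset.univ : Finset (Fin n → Bool)).card = 2 ^ n := by simp
  obtain ⟨e, he⟩ : ∃ e, e ∉ ({a, b, c, d} : Finset (Fin n → Bool)) := by
    by_contra! h
    have h1 := Finset.card_le_card (Finset.subset_iff.2 fun x (_ : x ∈ Finset.univ) => h x)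
    have h2 := Finset.card_le_four (a := a) (b := b) (c := c) (d := d)
    omega
  obtain ⟨f, hf⟩ : ∃ f, f ∉ ({e, a, b, c, d} : Finset (Fin n → Bool)) := by
    by_contra! h
    have h1 := Finset.card_le_card (Finset.subset_iff.2 fun x (_ : x ∈ Finset.univ) => h x)
    have h2 := Finset.card_le_five (a := e) (b := a) (c := b) (d := c) (e := d)
    omega
  simp only [Finset.mem_insert, Finset.mem_singleton, not_or] at he hf
  have r1 := swaps_disj hn a b e f hab (by tauto) (by tauto) (by tauto) (by tauto) (by tauto)
  have r2 := swaps_disj hn e f c d (by tauto) hcd (by tauto) (by tauto) (by tauto) (by tauto)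
  refine ((r1.comp r2).congr fun x => ?_).mono (by omega) (by omega)
  simp [Equiv.Perm.mul_apply]

theorem small_inv {X : Type*} [Fintype X] [DecidableEq X] (r : Equiv.Perm X) (hr : r * r = 1)
    (h : r.support.card < 4) : (r = 1 ∧ Equiv.Perm.sign r = 1) ∨
      (r.IsSwap ∧ Equiv.Perm.sign r = -1) := by
  obtain ⟨m, h1, h2⟩ := sign_inv r hr
  have : m = 0 ∨ m = 1 := by omega
  rcases this with rfl | rfl
  · left; exact ⟨by simpa using h1, by simpa using h2⟩
  · right; exact ⟨Equiv.Perm.card_support_eq_two.1 h1, by simpa using h2⟩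

theorem combi {s : ℕ} (hs : 1 ≤ s) (hn : 2 ^ 2 ^ (s + 1) + 2 ^ (s + 1) < n)
    (h : Equiv.Perm (Fin n → Bool)) (hh : Equiv.Perm.sign h = 1) :
    RlF h (2 * (2 ^ n / (2 * 2 ^ s)) * (2 * n + E s) + (2 * 2 ^ s + 2) * (2 * n + E 1))
        (2 * (2 ^ n / (2 * 2 ^ s)) * (8 * n + E s) + (2 * 2 ^ s + 2) * (8 * n + E 1)) := by
  have hn1 : 20 < n := by
    have h1 : 2 ^ (1 + 1) ≤ 2 ^ (s + 1) := Nat.pow_le_pow_right (by omega) (by omega)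
    have h2 : 2 ^ 2 ^ (1 + 1) ≤ 2 ^ 2 ^ (s + 1) := Nat.pow_le_pow_right (by omega) h1
    norm_num at h1 h2
    omega
  obtain ⟨a, b, hab, ha, hb⟩ := two_invol h
  obtain ⟨G, r, g1, g2, g3, g4, g5⟩ := chunk2 hs hn a ha
  obtain ⟨H, t, k1, k2, k3, k4, k5⟩ := chunk2 hs hn b hb
  obtain ⟨H', q1, q2, q3⟩ := k5.inv
  have hH' : ∀ x, H⁻¹ x = H' x := by
    intro x; rw [Equiv.Perm.inv_eq_iff_eq, q3]
  have hbe : b = t * H⁻¹ := by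
    have h1 : b = b⁻¹ := eq_inv_of_mul_eq_one_left hb
    have h2 : t = t⁻¹ := eq_inv_of_mul_eq_one_left k2
    rw [h1, k1, mul_inv_rev, ← h2]
  have hhe : h = G * (r * t) * H⁻¹ := by rw [hab, g1, hbe]; simp only [mul_assoc]
  have hsg : Equiv.Perm.sign r * Equiv.Perm.sign t = 1 := by
    have := hh
    rw [hhe] at this
    simpa [map_mul, g3, k3] using this
  have hrt : RlF ⇑(r * t) (2 * (2 * n + E 1)) (2 * (8 * n + E 1)) := by
    rcases small_inv r g2 g4 with ⟨e1, e2⟩ | ⟨e1, e2⟩ <;>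
      rcases small_inv t k2 k4 with ⟨e3, e4⟩ | ⟨e3, e4⟩
    · rw [e1, e3]
      exact (RlF.id.congr fun x => by simp).mono (by omega) (by omega)
    · rw [e2, e4] at hsg; simp at hsg
    · rw [e2, e4] at hsg; simp at hsg
    · exact swaps_two hn1 r t e1 e3
  refine ((g5.comp (hrt.comp q1)).congr fun x => ?_).mono ?_ ?_
  · rw [hhe]; simp only [Equiv.Perm.mul_apply, hH']
  · apply le_of_eq; ring
  · apply le_of_eq; ring

end RevCirc
namespace RevCirc
open Filter

theorem asy {ε c : ℝ} (h0 : 0 < ε) (h1 : ε < 1) (hc : 0 < c) : ∀ᶠ n : ℕ in atTop,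
    Real.logb 2 n ≤ ε / 56 * (n : ℝ) ^ ε ∧ Real.logb 2 n ≤ (n : ℝ) ^ (1 - ε) ∧
    8 ≤ (1 - ε) * Real.logb 2 n ∧ 36 * (n : ℝ) ^ 2 ≤ c * 2 ^ n ∧ 1352 ≤ (n : ℝ) := by
  have key : ∀ r d : ℝ, 0 < r → 0 < d → ∀ᶠ n : ℕ in atTop, Real.logb 2 n ≤ d * (n : ℝ) ^ r := by
    intro r d hr hd
    have hl : 0 < Real.log 2 := Real.log_pos (by norm_num)
    have h := (isLittleO_log_rpow_atTop hr).bound (mul_pos hd hl)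
    have h' := tendsto_natCast_atTop_atTop (R := ℝ) |>.eventually h
    filter_upwards [h'] with n hn
    rw [Real.logb, div_le_iff₀ hl]
    have h2 : ‖(n : ℝ) ^ r‖ = (n : ℝ) ^ r := by
      rw [Real.norm_eq_abs, abs_of_nonneg (by positivity)]
    rw [h2] at hn
    calc Real.log n ≤ ‖Real.log n‖ := le_abs_self _
      _ ≤ d * Real.log 2 * (n : ℝ) ^ r := hn
      _ = _ := by ring
  have k1 := key ε (ε / 56) h0 (by positivity)
  have k2 := key (1 - ε) 1 (by linarith) one_pos
  have k3 : ∀ᶠ n : ℕ in atTop, 8 / (1 - ε) ≤ Real.logb 2 n :=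
    ((Real.tendsto_logb_atTop (b := 2) (by norm_num)).comp
      (tendsto_natCast_atTop_atTop (R := ℝ))).eventually_ge_atTop _
  have k4 := (isLittleO_pow_const_const_pow_of_one_lt (R := ℝ) 2 (r := 2) (by norm_num)).bound
    (show 0 < c / 36 by positivity)
  have k5 : ∀ᶠ n : ℕ in atTop, 1352 ≤ (n : ℝ) :=
    (tendsto_natCast_atTop_atTop (R := ℝ)).eventually_ge_atTop _
  filter_upwards [k1, k2, k3, k4, k5] with n h1 h2 h3 h4 h5
  refine ⟨h1, by simpa using h2, ?_, ?_, h5⟩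
  · rw [div_le_iff₀ (by linarith)] at h3; linarith
  · simp only [norm_pow, Real.norm_natCast, Real.norm_ofNat] at h4
    linarith

theorem final_bound {A c ε δ L n k P T Ee : ℝ} (hε : ε = δ / 100) (hδ : 0 < δ) (hδ1 : δ ≤ 1)
    (hL : 0 < L) (hn : 1352 ≤ n) (hLn : L ≤ n) (hk : (1 - ε) * L < 2 * k) (hkL : k ≤ L)
    (hP : 0 < P) (hA : 0 ≤ A) (hA8 : A ≤ 8) (hE : Ee ≤ ε * n) (hE0 : 0 ≤ Ee)
    (hres : 36 * n ^ 2 ≤ δ * P) (hT : T ≤ 2 * (P / k) * (A * n + Ee) + (k + 2) * (A * n + 1352))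
    (hc : c = 4 * A) :
    T ≤ (c + δ) * n * P / L := by
  have hk0 : 0 < k := by nlinarith
  have hL2 : 2 ≤ 2 * n := by linarith
  rw [le_div_iff₀ hL]
  have e1 : 0 < 1 - ε := by rw [hε]; linarith
  have hn0 : 0 < n := by linarith
  -- main term
  have m1 : P / k * L * (1 - ε) ≤ 2 * P := by
    rw [div_mul_eq_mul_div, div_mul_eq_mul_div, div_le_iff₀ hk0]
    nlinarith
  have m2 : P / k * L ≤ 2 * P / (1 - ε) := by rwa [le_div_iff₀ e1]
  have m3 : 2 * (P / k) * (A * n + Ee) * L ≤ (c + δ / 2) * n * P := by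
    have hAe : A * n + Ee ≤ (A + ε) * n := by linarith
    have : 2 * (P / k) * (A * n + Ee) * L ≤ 2 * (2 * P / (1 - ε)) * ((A + ε) * n) := by
      calc 2 * (P / k) * (A * n + Ee) * L = 2 * (P / k * L) * (A * n + Ee) := by ring
        _ ≤ _ := by
          apply mul_le_mul (by linarith) hAe (by positivity)
          positivity
    refine this.trans ?_
    have : 2 * (2 * P / (1 - ε)) * ((A + ε) * n) = (4 * (A + ε)) / (1 - ε) * (n * P) := by
      field_simp; ring
    rw [this, mul_assoc]
    apply mul_le_mul_of_nonneg_right _ (by positivity)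
    rw [div_le_iff₀ e1, hc, hε]
    nlinarith
  have m4 : (k + 2) * (A * n + 1352) * L ≤ δ / 2 * n * P := by
    have a1 : k + 2 ≤ 2 * n := by linarith
    have a2 : A * n + 1352 ≤ 9 * n := by nlinarith
    have a3 : (k + 2) * (A * n + 1352) * L ≤ (2 * n) * (9 * n) * n := by
      apply mul_le_mul _ hLn hL.le (by positivity)
      apply mul_le_mul a1 a2 (by positivity) (by positivity)
    refine a3.trans ?_
    have : n * (36 * n ^ 2) ≤ n * (δ * P) := mul_le_mul_of_nonneg_left hres hn0.le
    linarith
  calc T * L ≤ (2 * (P / k) * (A * n + Ee) + (k + 2) * (A * n + 1352)) * L :=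
        mul_le_mul_of_nonneg_right hT hL.le
    _ = 2 * (P / k) * (A * n + Ee) * L + (k + 2) * (A * n + 1352) * L := by ring
    _ ≤ (c + δ) * n * P := by linarith

end RevCirc

/-- Theorem: every even permutation of `ℤ₂ⁿ` (for large `n`) is realized by a circuit
without additional inputs containing at most `(16 + δ)·n·2ⁿ/log₂ n` NOT and CNOT gates
and at most `(32 + δ)·n·2ⁿ/log₂ n` 2-CNOT gates. -/
theorem gate_counts_upper_bound_no_memory :
    ∀ δ : ℝ, 0 < δ → ∃ n₀ : ℕ, ∀ n : ℕ, n > n₀ →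
      ∀ h : Equiv.Perm (Fin n → Bool), h ∈ alternatingGroup (Fin n → Bool) →
        ∃ c : List (RevCirc.Gate n), RevCirc.realizes c h ∧
          ((c.countP fun g => decide (g.controls.card ≤ 1)) : ℝ) ≤
            (16 + δ) * n * 2 ^ n / Real.logb 2 n ∧
          ((c.countP fun g => decide (g.controls.card = 2)) : ℝ) ≤
            (32 + δ) * n * 2 ^ n / Real.logb 2 n := by
  intro δ0 hδ0
  obtain ⟨δ, hδ, hδ1, hδδ⟩ : ∃ δ : ℝ, 0 < δ ∧ δ ≤ 1 ∧ δ ≤ δ0 :=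
    ⟨min δ0 1, lt_min hδ0 one_pos, min_le_right _ _, min_le_left _ _⟩
  obtain ⟨ε, hε⟩ : ∃ ε : ℝ, ε = δ / 100 := ⟨_, rfl⟩
  have hε0 : 0 < ε := by rw [hε]; positivity
  have hε1 : ε < 1 := by rw [hε]; linarith
  obtain ⟨n₀, hn₀⟩ := Filter.eventually_atTop.1 (RevCirc.asy hε0 hε1 hδ)
  refine ⟨n₀, fun n hn h hh => ?_⟩
  obtain ⟨a1, a2, a3, a4, a5⟩ := hn₀ n hn.le
  have hnpos : (0 : ℝ) < n := by linarith
  set L := Real.logb 2 n with hL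
  have hL8 : 8 ≤ L := by
    have : 0 < L := by
      by_contra hneg
      push Not at hneg
      nlinarith
    nlinarith
  obtain ⟨m, hm1, hm2⟩ := exists_nat_pow_near (x := (1 - ε) * L) (y := 2) (by linarith)
    (by norm_num)
  have hm : 2 ≤ m := by
    by_contra hlt
    have h3 : (2 : ℝ) ^ (m + 1) ≤ 2 ^ 2 := pow_le_pow_right₀ (by norm_num) (by omega)
    norm_num at h3
    linarith
  obtain ⟨s, rfl⟩ : ∃ s, m = s + 1 := ⟨m - 1, by omega⟩
  have hs : 1 ≤ s := by omega
  have hkL : (2 : ℝ) ^ (s + 1) ≤ L := by nlinarith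
  have hy : (2 : ℝ) ^ 2 ^ (s + 1) ≤ (n : ℝ) ^ (1 - ε) := by
    have e1 : (n : ℝ) ^ (1 - ε) = (2 : ℝ) ^ ((1 - ε) * L) := by
      rw [mul_comm, Real.rpow_mul (by norm_num), hL, Real.rpow_logb (by norm_num) (by norm_num) hnpos]
    rw [e1, ← Real.rpow_natCast]
    apply Real.rpow_le_rpow_of_exponent_le (by norm_num)
    push_cast
    exact hm1
  set y := (n : ℝ) ^ (1 - ε) with hydef
  have hLy : 56 * (L * y) ≤ ε * n := by
    have e1 : (n : ℝ) ^ ε * y = n := by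
      rw [hydef, ← Real.rpow_add hnpos]; simp
    have hy0 : 0 ≤ y := by positivity
    have := mul_le_mul_of_nonneg_right a1 hy0
    rw [mul_assoc, e1] at this
    linarith
  have hy8 : 8 ≤ y := by linarith
  have hE : ((RevCirc.E s : ℕ) : ℝ) ≤ ε * n := by
    refine le_trans ?_ hLy
    unfold RevCirc.E
    push_cast
    have hk0 : (0 : ℝ) < 2 ^ (s + 1) := by positivity
    have b1 : (2 : ℝ) ^ (s + 1) * (8 * (2 ^ 2 ^ (s + 1) + 2 ^ (s + 1)) + 8) ≤
        L * (24 * y) := by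
      apply mul_le_mul hkL _ (by positivity) (by linarith)
      linarith
    nlinarith
  have hn' : 2 ^ 2 ^ (s + 1) + 2 ^ (s + 1) < n := by
    have : (2 : ℝ) ^ 2 ^ (s + 1) + 2 ^ (s + 1) < n := by nlinarith
    exact_mod_cast this
  obtain ⟨c, hc1, hc2, hc3⟩ := RevCirc.combi hs hn' h (Equiv.Perm.mem_alternatingGroup.1 hh)
  have hLn : L ≤ n := by nlinarith
  have hE1 : RevCirc.E 1 = 1352 := by norm_num [RevCirc.E]
  rw [hE1] at hc2 hc3
  have hdiv : ((2 ^ n / 2 ^ (s + 1) : ℕ) : ℝ) ≤ 2 ^ n / 2 ^ (s + 1) := by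
    refine Nat.cast_div_le.trans (le_of_eq ?_)
    push_cast
    rfl
  have hk2 : (1 - ε) * L < 2 * 2 ^ (s + 1) := by rw [← pow_succ']; exact hm2
  have hmono : ∀ A : ℝ, (A + δ) * n * 2 ^ n / L ≤ (A + δ0) * n * 2 ^ n / L := by
    intro A
    gcongr
  refine ⟨c, hc1, ?_, ?_⟩
  · have hT : ((c.countP fun g => decide (g.controls.card ≤ 1) : ℕ) : ℝ) ≤
        2 * (2 ^ n / 2 ^ (s + 1)) * (2 * n + (RevCirc.E s : ℕ)) +
          (2 ^ (s + 1) + 2) * (2 * n + 1352) := by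
      have h1 : ((c.countP fun g => decide (g.controls.card ≤ 1) : ℕ) : ℝ) ≤ _ := Nat.cast_le.2 hc2
      refine h1.trans ?_
      rw [Nat.cast_add, Nat.cast_mul, Nat.cast_mul, Nat.cast_mul, Nat.cast_ofNat, ← pow_succ']
      push_cast
      gcongr
    have := RevCirc.final_bound (A := 2) (c := 8) hε hδ hδ1 (by linarith) a5 hLn hk2 hkL
      (by positivity) (by norm_num) (by norm_num) hE (by positivity) a4 hT (by norm_num)
    refine this.trans (le_trans ?_ (hmono 16))
    gcongr
    norm_num
  · have hT : ((c.countP fun g => decide (g.controls.card = 2) : ℕ) : ℝ) ≤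
        2 * (2 ^ n / 2 ^ (s + 1)) * (8 * n + (RevCirc.E s : ℕ)) +
          (2 ^ (s + 1) + 2) * (8 * n + 1352) := by
      have h1 : ((c.countP fun g => decide (g.controls.card = 2) : ℕ) : ℝ) ≤ _ := Nat.cast_le.2 hc3
      refine h1.trans ?_
      rw [Nat.cast_add, Nat.cast_mul, Nat.cast_mul, Nat.cast_mul, Nat.cast_ofNat, ← pow_succ']
      push_cast
      gcongr
    have := RevCirc.final_bound (A := 8) (c := 32) hε hδ hδ1 (by linarith) a5 hLn hk2 hkL
      (by positivity) (by norm_num) (by norm_num) hE (by positivity) a4 hT (by norm_num)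
    exact this.trans (hmono 32)
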